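/- arXiv:math/9908100 — 9 statements merged into one kernel-verified Lean document; each statement's English description precedes it below -/
import Mathlib

section
/- Let f : ℝ → ℝ be twice continuously differentiable, and suppose there exist T > 0 and m > 0 such that f''(x) ≥ m whenever |x| > T. Then for every fixed s ∈ ℝ, the value of the tangent line to f at c evaluated at s, namely T_c(s) = f(c) + f'(c)·(s − c), tends to −∞ as |c| → ∞ (i.e., tends to −∞ both as c → ∞ and as c → −∞). -/
open Filter

theorem tendsto_atBot_of_hasDerivAt_le {g g' : ℝ → ℝ} {A C : ℝ} (hC : C < 0)
    (hg : ∀ x, HasDerivAt g (g' x) x) (hle : ∀ x, A ≤ x → g' x ≤ C) :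
    Tendsto g atTop atBot := by
  have hdiff : Differentiable ℝ g := fun x => (hg x).differentiableAt
  have hlin : Tendsto (fun x : ℝ => g A + C * (x - A)) atTop atBot :=
    tendsto_atBot_add_const_left _ _
      ((tendsto_atTop_add_const_right _ (-A) tendsto_id).const_mul_atTop_of_neg hC)
  refine tendsto_atBot_mono' _ ?_ hlin
  filter_upwards [eventually_ge_atTop A] with x hx
  have hmvt := (convex_Ici A).image_sub_le_mul_sub_of_deriv_le hdiff.continuous.continuousOn
    hdiff.differentiableOn (C := C)
    (fun y hy => (hg y).deriv.trans_le (hle y (interior_subset hy)))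
    A Set.self_mem_Ici x hx hx
  linarith

theorem hasDerivAt_tangent_value {f : ℝ → ℝ} (hf : ContDiff ℝ 2 f) (s c : ℝ) :
    HasDerivAt (fun c : ℝ => f c + deriv f c * (s - c)) (iteratedDeriv 2 f c * (s - c)) c := by
  have h1 : HasDerivAt f (deriv f c) c := (hf.differentiable (by norm_num) c).hasDerivAt
  have h2 : HasDerivAt (deriv f) (iteratedDeriv 2 f c) c := by
    have h := (hf.differentiable_iteratedDeriv 1 (by norm_num) c).hasDerivAt
    rwa [← iteratedDeriv_succ, iteratedDeriv_one] at h
  exact (h1.add (h2.mul ((hasDerivAt_id' c).const_sub s))).congr_deriv (by ring)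

/-- **Lemma 1 (Horwitz).** If `f` is `C²` and `f'' ≥ m > 0` outside `[-T, T]`, then for any
fixed `s`, the tangent line value `T_c(s) = f(c) + f'(c)·(s - c)` tends to `-∞` as `|c| → ∞`. -/
theorem tangent_value_tendsto_atBot
    (f : ℝ → ℝ) (hf : ContDiff ℝ 2 f)
    (T m : ℝ) (hT : 0 < T) (hm : 0 < m)
    (hbound : ∀ x : ℝ, T < |x| → m ≤ iteratedDeriv 2 f x)
    (s : ℝ) :
    Tendsto (fun c : ℝ => f c + deriv f c * (s - c)) atTop atBot ∧
    Tendsto (fun c : ℝ => f c + deriv f c * (s - c)) atBot atBot := by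
  have hderiv := hasDerivAt_tangent_value hf s
  constructor
  · refine tendsto_atBot_of_hasDerivAt_le (A := max T s + 1) (neg_lt_zero.mpr hm) hderiv ?_
    intro x hx
    have hTx := le_max_left T s
    have hsx := le_max_right T s
    have hx2 := hbound x (lt_of_lt_of_le (by linarith) (le_abs_self x))
    nlinarith
  · have hneg : Tendsto (fun c : ℝ => f (-c) + deriv f (-c) * (s - -c)) atTop atBot := by
      refine tendsto_atBot_of_hasDerivAt_le (A := max T (-s) + 1) (neg_lt_zero.mpr hm)
        (fun x => (hderiv (-x)).comp x (hasDerivAt_neg x)) ?_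
      intro x hx
      have hTx := le_max_left T (-s)
      have hsx := le_max_right T (-s)
      have hx2 := hbound (-x) (by rw [abs_neg]; exact lt_of_lt_of_le (by linarith) (le_abs_self x))
      nlinarith
    simpa only [Function.comp_def, neg_neg] using hneg.comp tendsto_neg_atBot_atTop
end

section
/- Let f : ℝ → ℝ be twice differentiable with f'' continuous, nonnegative on ℝ, and such that the set {x : f''(x) = 0} is finite. Then for any point P = (s, t) in the plane, at most two distinct tangent lines to the graph of f pass through P; that is, there do not exist c₁ < c₂ < c₃ such that the three affine functions x ↦ f(cᵢ) + f'(cᵢ)·(x − cᵢ), i = 1, 2, 3, are pairwise distinct and all satisfy f(cᵢ) + f'(cᵢ)·(s − cᵢ) = t. -/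
/-- A differentiable function with nonnegative derivative vanishing at only finitely many points
is strictly monotone. -/
theorem strictMono_of_deriv_nonneg_of_finite {g : ℝ → ℝ} (hg : Differentiable ℝ g)
    (hnonneg : ∀ x, 0 ≤ deriv g x) (hfin : {x | deriv g x = 0}.Finite) : StrictMono g := by
  have hmono : Monotone g := monotone_of_deriv_nonneg hg hnonneg
  refine hmono.strictMono_of_injective (Function.Injective.of_lt_imp_ne fun a b hab heq => ?_)
  refine (Set.Ioo_infinite hab) (hfin.subset fun x hx => ?_)
  have hconst : g =ᶠ[nhds x] fun _ => g a := by
    filter_upwards [Ioo_mem_nhds hx.1 hx.2] with y hy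
    exact le_antisymm (heq ▸ hmono hy.2.le) (hmono hy.1.le)
  simp [hconst.deriv_eq]

/-- If `f'` is strictly increasing, then the slope of a chord of `f` lies strictly between the
values of `f'` at its endpoints. -/
theorem StrictMono.deriv_mul_sub_lt_sub_lt {f : ℝ → ℝ} (hf : Differentiable ℝ f)
    (hmono : StrictMono (deriv f)) {c d : ℝ} (hcd : c < d) :
    deriv f c * (d - c) < f d - f c ∧ f d - f c < deriv f d * (d - c) := by
  obtain ⟨x, hx, hslope⟩ :=
    exists_deriv_eq_slope f hcd hf.continuous.continuousOn hf.differentiableOn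
  have hpos : 0 < d - c := sub_pos.2 hcd
  rw [eq_div_iff hpos.ne'] at hslope
  rw [← hslope]
  exact ⟨mul_lt_mul_of_pos_right (hmono hx.1) hpos, mul_lt_mul_of_pos_right (hmono hx.2) hpos⟩

/-- **Lemma 2 (Horwitz).** If `f''` is continuous, nonnegative, and has finitely many zeros
on `ℝ`, then at most two distinct tangent lines to the graph of `f` can pass through any
given point `(s, t)` in the plane. -/
theorem at_most_two_tangents_through_point
    (f : ℝ → ℝ) (hf : ContDiff ℝ 2 f)
    (hnonneg : ∀ x : ℝ, 0 ≤ iteratedDeriv 2 f x)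
    (hfin : {x : ℝ | iteratedDeriv 2 f x = 0}.Finite)
    (s t : ℝ) :
    ¬ ∃ c₁ c₂ c₃ : ℝ, c₁ < c₂ ∧ c₂ < c₃ ∧
      (fun x => f c₁ + deriv f c₁ * (x - c₁)) ≠ (fun x => f c₂ + deriv f c₂ * (x - c₂)) ∧
      (fun x => f c₁ + deriv f c₁ * (x - c₁)) ≠ (fun x => f c₃ + deriv f c₃ * (x - c₃)) ∧
      (fun x => f c₂ + deriv f c₂ * (x - c₂)) ≠ (fun x => f c₃ + deriv f c₃ * (x - c₃)) ∧
      f c₁ + deriv f c₁ * (s - c₁) = t ∧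
      f c₂ + deriv f c₂ * (s - c₂) = t ∧
      f c₃ + deriv f c₃ * (s - c₃) = t := by
  rintro ⟨c₁, c₂, c₃, h₁₂, h₂₃, -, -, -, h₁, h₂, h₃⟩
  have hf' : Differentiable ℝ f := hf.differentiable (by norm_num)
  have hf'' : Differentiable ℝ (deriv f) := by
    simpa using hf.differentiable_iteratedDeriv 1 (by norm_num)
  simp only [iteratedDeriv_succ, iteratedDeriv_zero] at hnonneg hfin
  have hmono : StrictMono (deriv f) := strictMono_of_deriv_nonneg_of_finite hf'' hnonneg hfin
  rcases le_total c₂ s with hs | hs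
  · have hchord := (hmono.deriv_mul_sub_lt_sub_lt hf' h₁₂).1
    have hle := mul_le_mul_of_nonneg_right (hmono h₁₂).le (sub_nonneg.2 hs)
    linarith
  · have hchord := (hmono.deriv_mul_sub_lt_sub_lt hf' h₂₃).2
    have hle := mul_le_mul_of_nonneg_right (hmono h₂₃).le (sub_nonneg.2 hs)
    linarith
end

section
/- Let f : ℝ → ℝ be twice differentiable with f'' continuous and nonnegative on ℝ and with {x : f''(x) = 0} finite, and suppose f'' has a nonzero zero set only inside a bounded region: there exist T > 0 and m > 0 such that f''(x) ≥ m whenever |x| > T. Then distinct points of tangency give distinct tangent lines, and for every point P = (s, t) with t < f(s), the set {c ∈ ℝ : f(c) + f'(c)·(s − c) = t} has exactly two elements; equivalently, exactly two distinct tangent lines to the graph of f pass through P. -/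
/-- A differentiable function whose derivative is nonnegative on a convex set and vanishes there
at only finitely many points is strictly increasing on that set. -/
theorem strictMonoOn_of_hasDerivAt_nonneg_of_finite_zeros {h h' : ℝ → ℝ} {D : Set ℝ}
    (hD : Convex ℝ D) (hh : ∀ x, HasDerivAt h (h' x) x) (hnonneg : ∀ x ∈ D, 0 ≤ h' x)
    (hfin : {x ∈ D | h' x = 0}.Finite) : StrictMonoOn h D := by
  have hmono : MonotoneOn h D :=
    monotoneOn_of_deriv_nonneg hD (fun x _ => (hh x).continuousAt.continuousWithinAt)
      (fun x _ => (hh x).differentiableAt.differentiableWithinAt)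
      (fun x hx => (hh x).deriv ▸ hnonneg x (interior_subset hx))
  intro a ha b hb hab
  refine (hmono ha hb hab.le).lt_of_ne fun heq => ?_
  refine Set.Ioo_infinite hab (hfin.subset fun x hx => ?_)
  have hsub : Set.Icc a b ⊆ D := hD.ordConnected.out ha hb
  refine ⟨hsub (Set.Ioo_subset_Icc_self hx), (hh x).unique ?_⟩
  refine (hasDerivAt_const x (h a)).congr_of_eventuallyEq ?_
  filter_upwards [Ioo_mem_nhds hx.1 hx.2] with y hy
  have hyD := hsub (Set.Ioo_subset_Icc_self hy)
  exact le_antisymm (heq ▸ hmono hyD hb hy.2.le) (hmono ha hyD hy.1.le)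

/-- A differentiable function whose derivative is eventually at most `-m < 0` takes values
below any given level arbitrarily far to the right. -/
theorem exists_ge_lt_of_hasDerivAt_le_neg {h h' : ℝ → ℝ} {A m : ℝ} (hm : 0 < m)
    (hh : ∀ x, HasDerivAt h (h' x) x) (hle : ∀ x, A < x → h' x ≤ -m) (t : ℝ) :
    ∃ c, A ≤ c ∧ h c < t := by
  have key : ∀ c, A ≤ c → h c - h A ≤ -m * (c - A) := fun c hc =>
    (convex_Ici A).image_sub_le_mul_sub_of_deriv_le
      (fun x _ => (hh x).continuousAt.continuousWithinAt)
      (fun x _ => (hh x).differentiableAt.differentiableWithinAt)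
      (fun x hx => (hh x).deriv ▸ hle x (by simpa using hx))
      A Set.self_mem_Ici c hc hc
  have hpos : 0 ≤ |h A - t| / m := by positivity
  refine ⟨A + (|h A - t| / m + 1), by linarith, ?_⟩
  have hval := key (A + (|h A - t| / m + 1)) (by linarith)
  have hmul : -m * (A + (|h A - t| / m + 1) - A) = -|h A - t| - m := by
    field_simp
    ring
  linarith [le_abs_self (h A - t)]

/-- **Theorem 1 (Horwitz).** Suppose `f''` is continuous, nonnegative, with finitely many
zeros on `ℝ`, and `f'' ≥ m > 0` outside `[-T, T]`. Then distinct points of tangency give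
distinct tangent lines, and every point `(s, t)` strictly below the graph of `f` is
illuminated by exactly two tangent lines. -/
theorem exactly_two_tangents_below_graph
    (f : ℝ → ℝ) (hf : ContDiff ℝ 2 f)
    (hnonneg : ∀ x : ℝ, 0 ≤ iteratedDeriv 2 f x)
    (hfin : {x : ℝ | iteratedDeriv 2 f x = 0}.Finite)
    (T m : ℝ) (hT : 0 < T) (hm : 0 < m)
    (hbound : ∀ x : ℝ, T < |x| → m ≤ iteratedDeriv 2 f x) :
    (∀ c₁ c₂ : ℝ, c₁ ≠ c₂ →
      (fun x => f c₁ + deriv f c₁ * (x - c₁)) ≠ (fun x => f c₂ + deriv f c₂ * (x - c₂))) ∧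
    ∀ s t : ℝ, t < f s →
      {c : ℝ | f c + deriv f c * (s - c) = t}.ncard = 2 := by
  have hf' : ∀ x, HasDerivAt f (deriv f x) x := fun x =>
    (hf.differentiable (by norm_num) x).hasDerivAt
  have hf'' : ∀ x, HasDerivAt (deriv f) (iteratedDeriv 2 f x) x := fun x => by
    have hd := (hf.differentiable_iteratedDeriv 1 (by norm_num) x).hasDerivAt
    rwa [← iteratedDeriv_succ, iteratedDeriv_one] at hd
  refine ⟨fun c₁ c₂ hne heq => hne ?_, fun s t hst => ?_⟩
  · have hmono := strictMonoOn_of_hasDerivAt_nonneg_of_finite_zeros convex_univ hf''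
      (fun x _ => hnonneg x) (hfin.subset fun x hx => hx.2)
    refine hmono.injOn (Set.mem_univ _) (Set.mem_univ _) ?_
    have h₀ := congrFun heq 0
    have h₁ := congrFun heq 1
    linarith
  set g : ℝ → ℝ := fun c => f c + deriv f c * (s - c) with hg
  have hg' : ∀ x, HasDerivAt g (iteratedDeriv 2 f x * (s - x)) x := fun x => by
    refine ((hf' x).add ((hf'' x).mul ((hasDerivAt_id x).const_sub s))).congr_deriv ?_
    simp only [id]
    ring
  have hgcont : Continuous g := continuous_iff_continuousAt.2 fun x => (hg' x).continuousAt
  have hgs : g s = f s := by simp [hg]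
  have hzeros : {x | iteratedDeriv 2 f x * (s - x) = 0}.Finite := by
    refine (hfin.insert s).subset fun x hx => ?_
    rcases mul_eq_zero.1 hx with h | h
    · exact Or.inr h
    · exact Or.inl (by linarith)
  have hleft : StrictMonoOn g (Set.Iic s) :=
    strictMonoOn_of_hasDerivAt_nonneg_of_finite_zeros (convex_Iic s) hg'
      (fun x hx => mul_nonneg (hnonneg x) (sub_nonneg.2 hx)) (hzeros.subset fun x hx => hx.2)
  have hright : StrictMonoOn (fun x => -g x) (Set.Ici s) :=
    strictMonoOn_of_hasDerivAt_nonneg_of_finite_zeros (convex_Ici s) (fun x => (hg' x).neg)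
      (fun x hx => by
        rw [← mul_neg, neg_sub]
        exact mul_nonneg (hnonneg x) (sub_nonneg.2 hx))
      (hzeros.subset fun x hx => neg_eq_zero.1 hx.2)
  obtain ⟨b, hb, hbt⟩ : ∃ b, max T (s + 1) ≤ b ∧ g b < t := by
    refine exists_ge_lt_of_hasDerivAt_le_neg hm hg' (fun x hx => ?_) t
    obtain ⟨hTx, hsx⟩ := max_lt_iff.1 hx
    nlinarith [hbound x (hTx.trans_le (le_abs_self x))]
  obtain ⟨a, ha, hat⟩ : ∃ a, max T (1 - s) ≤ a ∧ g (-a) < t := by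
    refine exists_ge_lt_of_hasDerivAt_le_neg hm
      (fun x => (hg' (-x)).comp x (hasDerivAt_neg x)) (fun x hx => ?_) t
    obtain ⟨hTx, hsx⟩ := max_lt_iff.1 hx
    nlinarith [hbound (-x) (by rw [abs_neg]; exact hTx.trans_le (le_abs_self x))]
  have has : -a ≤ s := by linarith [(le_max_right T (1 - s)).trans ha]
  have hsb : s ≤ b := by linarith [(le_max_right T (s + 1)).trans hb]
  obtain ⟨p, hp, hpt⟩ := intermediate_value_Ioo has hgcont.continuousOn ⟨hat, hgs ▸ hst⟩
  obtain ⟨q, hq, hqt⟩ := intermediate_value_Ioo' hsb hgcont.continuousOn ⟨hbt, hgs ▸ hst⟩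
  refine Set.ncard_eq_two.2 ⟨p, q, (hp.2.trans hq.1).ne, Set.ext fun c => ⟨fun hc => ?_, ?_⟩⟩
  · have hct : g c = t := hc
    rcases le_total c s with h | h
    · exact Or.inl (hleft.injOn h hp.2.le (hct.trans hpt.symm))
    · exact Or.inr (hright.injOn h hq.1.le (congrArg Neg.neg (hct.trans hqt.symm)))
  · rintro (rfl | rfl)
    exacts [hpt, hqt]
end

section
/- Let f(x) = sin x and let P = (s, t) be a point with t ≠ sin s, t ≠ 1, and t ≠ −1. Then infinitely many distinct tangent lines to the graph of f pass through P; that is, the set of affine functions { x ↦ sin c + (cos c)·(x − c) : c ∈ ℝ, sin c + (s − c)·cos c = t } is infinite. -/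
/-- Tangent lines to the sine curve through `(s, t)` have arbitrarily large abscissas of
tangency. -/
theorem exists_gt_sin_tangent_through (s t B : ℝ) :
    ∃ c, B < c ∧ Real.sin c + (s - c) * Real.cos c = t := by
  obtain ⟨N, hN⟩ := exists_nat_gt (|B| + |s| + |t|)
  have hπ := Real.pi_gt_three
  have hN0 : (0 : ℝ) ≤ N := N.cast_nonneg
  have hlt : |B| + |s| + |t| < N * (2 * Real.pi) := by nlinarith
  have hcont : ContinuousOn (fun c => Real.sin c + (s - c) * Real.cos c)
      (Set.Icc (N * (2 * Real.pi)) (N * (2 * Real.pi) + Real.pi)) := by fun_prop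
  have hmem : t ∈ Set.Icc
      ((fun c => Real.sin c + (s - c) * Real.cos c) (N * (2 * Real.pi)))
      ((fun c => Real.sin c + (s - c) * Real.cos c) (N * (2 * Real.pi) + Real.pi)) := by
    have hsin : Real.sin (N * (2 * Real.pi)) = 0 := by
      simpa using Real.sin_add_nat_mul_two_pi 0 N
    simp only [Real.sin_add_pi, Real.cos_add_pi, hsin, Real.cos_nat_mul_two_pi]
    constructor <;>
      linarith [abs_nonneg B, le_abs_self s, neg_abs_le s, le_abs_self t, neg_abs_le t]
  obtain ⟨c, hc, h⟩ := intermediate_value_Icc (by linarith) hcont hmem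
  exact ⟨c, by linarith [hc.1, le_abs_self B, abs_nonneg s, abs_nonneg t], h⟩

/-- For `t ≠ ±1`, a tangent line to the sine curve through `(s, t)` is not horizontal. -/
theorem cos_ne_zero_of_sin_tangent_through {s t c : ℝ} (ht1 : t ≠ 1) (ht2 : t ≠ -1)
    (h : Real.sin c + (s - c) * Real.cos c = t) : Real.cos c ≠ 0 := by
  intro hc
  have hsin : Real.sin c = t := by simpa [hc] using h
  rcases Real.cos_eq_zero_iff_sin_eq.mp hc with h' | h'
  · exact ht1 (hsin.symm.trans h')
  · exact ht2 (hsin.symm.trans h')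

/-- The points of tangency of the tangent lines to the sine curve through `(s, t)` with a given
nonzero slope lie within bounded distance of `s`. -/
theorem abs_sub_le_of_sin_tangent_through {s t c : ℝ} (hcos : Real.cos c ≠ 0)
    (h : Real.sin c + (s - c) * Real.cos c = t) : |c - s| ≤ (1 + |t|) / |Real.cos c| := by
  rw [le_div_iff₀ (abs_pos.mpr hcos), ← abs_mul]
  calc |(c - s) * Real.cos c| = |Real.sin c - t| := by congr 1; linarith
    _ ≤ |Real.sin c| + |t| := abs_sub _ _
    _ ≤ 1 + |t| := by gcongr; exact Real.abs_sin_le_one c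

/-- For `f(x) = sin x` and any point `(s, t)` not on the graph with `t ≠ ±1`, infinitely
many distinct tangent lines to the graph of `f` pass through `(s, t)`. -/
theorem sin_infinite_illumination_index
    (s t : ℝ) (hts : t ≠ Real.sin s) (ht1 : t ≠ 1) (ht2 : t ≠ -1) :
    {g : ℝ → ℝ | ∃ c : ℝ, Real.sin c + (s - c) * Real.cos c = t ∧
      g = fun x => Real.sin c + Real.cos c * (x - c)}.Infinite := by
  intro hfin
  obtain ⟨M, hM⟩ := (hfin.image fun g => (1 + |t|) / |g 1 - g 0|).bddAbove
  obtain ⟨c, hc, h⟩ := exists_gt_sin_tangent_through s t (s + M)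
  have hle := hM (Set.mem_image_of_mem _ ⟨c, h, rfl⟩)
  have hslope : Real.sin c + Real.cos c * (1 - c) - (Real.sin c + Real.cos c * (0 - c))
      = Real.cos c := by ring
  simp only [hslope] at hle
  have hcos := cos_ne_zero_of_sin_tangent_through ht1 ht2 h
  linarith [le_abs_self (c - s), abs_sub_le_of_sin_tangent_through hcos h]
end

section
/- Equation sin c + (s − c)·cos c = t, which characterizes when the tangent line to sin x at c passes through (s, t), has infinitely many real solutions c for every s, t ∈ ℝ with t ≠ 1 and t ≠ −1. -/
/-- The equation `sin c + (s - c) cos c = t`, characterizing when the tangent line to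
`sin x` at `c` passes through `(s, t)`, has infinitely many real solutions `c` whenever
`t ≠ ±1`. -/
theorem sin_tangent_equation_infinitely_many_solutions
    (s t : ℝ) (ht1 : t ≠ 1) (ht2 : t ≠ -1) :
    {c : ℝ | Real.sin c + (s - c) * Real.cos c = t}.Infinite := by
  refine Set.infinite_of_forall_exists_gt fun a => ?_
  obtain ⟨n, hn⟩ := exists_nat_gt (|a| + |s| + |t|)
  have ha := le_abs_self a
  have hs := abs_le.mp (le_refl |s|)
  have ht := abs_le.mp (le_refl |t|)
  have ha0 := abs_nonneg a
  have hs0 := abs_nonneg s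
  have ht0 := abs_nonneg t
  have hpi := Real.pi_gt_three
  have hle : (n : ℝ) ≤ n * (2 * Real.pi) := by nlinarith
  have hcont : ContinuousOn (fun c : ℝ => Real.sin c + (s - c) * Real.cos c)
      (Set.Icc (n * (2 * Real.pi)) (n * (2 * Real.pi) + Real.pi)) := by fun_prop
  have hcos := Real.cos_nat_mul_two_pi n
  have hsin : Real.sin (n * (2 * Real.pi)) = 0 := by
    simpa using Real.sin_add_nat_mul_two_pi 0 n
  obtain ⟨c, hc, hct⟩ := intermediate_value_Icc (by linarith) hcont
    (show t ∈ Set.Icc _ _ by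
      simp only [Real.sin_add_pi, Real.cos_add_pi, hcos, hsin]
      constructor <;> linarith)
  exact ⟨c, hct, by linarith [hc.1]⟩
end

section
/- For f(x) = x³ and any point (s, t) with s > 0 and 0 < t < s³, exactly three distinct tangent lines to the graph of f pass through (s, t); that is, the set {c ∈ ℝ : c³ + 3c²·(s − c) = t} has exactly three elements, and the corresponding tangent lines x ↦ c³ + 3c²·(x − c) are pairwise distinct. -/
/-- For `f(x) = x³` and any point `(s, t)` with `s > 0` and `0 < t < s³`, exactly three
distinct tangent lines to the graph of `f` pass through `(s, t)`. -/
theorem cubic_three_tangents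
    (s t : ℝ) (hs : 0 < s) (ht0 : 0 < t) (hts : t < s ^ 3) :
    {c : ℝ | c ^ 3 + 3 * c ^ 2 * (s - c) = t}.ncard = 3 ∧
    ∀ c₁ ∈ {c : ℝ | c ^ 3 + 3 * c ^ 2 * (s - c) = t},
      ∀ c₂ ∈ {c : ℝ | c ^ 3 + 3 * c ^ 2 * (s - c) = t}, c₁ ≠ c₂ →
        (fun x => c₁ ^ 3 + 3 * c₁ ^ 2 * (x - c₁)) ≠
          (fun x => c₂ ^ 3 + 3 * c₂ ^ 2 * (x - c₂)) := by
  constructor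
  · have hcont : Continuous fun c : ℝ => c ^ 3 + 3 * c ^ 2 * (s - c) := by fun_prop
    have hs3 : 0 < s ^ 3 := by positivity
    obtain ⟨a, ⟨-, ha0⟩, ha⟩ := intermediate_value_Ioo' (by linarith : -s / 2 ≤ 0)
      hcont.continuousOn (show t ∈ Set.Ioo _ _ from ⟨by simpa using ht0, by ring_nf; linarith⟩)
    obtain ⟨b, ⟨hb0, hbs⟩, hb⟩ := intermediate_value_Ioo hs.le
      hcont.continuousOn (show t ∈ Set.Ioo _ _ from ⟨by simpa using ht0, by simpa using hts⟩)
    obtain ⟨d, ⟨hds, -⟩, hd⟩ := intermediate_value_Ioo' (by linarith : s ≤ 3 * s / 2)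
      hcont.continuousOn (show t ∈ Set.Ioo _ _ from ⟨by ring_nf; linarith, by simpa using hts⟩)
    dsimp only at ha hb hd
    have hab : a ≠ b := (ha0.trans hb0).ne
    have had : a ≠ d := (ha0.trans (hs.trans hds)).ne
    have hbd : b ≠ d := (hbs.trans hds).ne
    have eab : 3 * s * (a + b) = 2 * (a ^ 2 + a * b + b ^ 2) :=
      mul_left_cancel₀ (sub_ne_zero.2 hab) (by linear_combination ha - hb)
    have ead : 3 * s * (a + d) = 2 * (a ^ 2 + a * d + d ^ 2) :=
      mul_left_cancel₀ (sub_ne_zero.2 had) (by linear_combination ha - hd)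
    have esum : 3 * s = 2 * (a + b + d) :=
      mul_left_cancel₀ (sub_ne_zero.2 hbd) (by linear_combination eab - ead)
    refine Set.ncard_eq_three.2 ⟨a, b, d, hab, had, hbd, ?_⟩
    ext c
    simp only [Set.mem_ofPred_eq, Set.mem_insert_iff, Set.mem_singleton_iff]
    constructor
    · intro hc
      have hprod : (c - a) * ((c - b) * (c - d)) = 0 := by
        linear_combination (-1 / 2) * (hc - ha) + (c - a) / 2 * eab +
          (c - a) * (c - b) / 2 * esum
      simpa only [mul_eq_zero, sub_eq_zero] using hprod
    · rintro (rfl | rfl | rfl) <;> assumption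
  · intro c₁ _ c₂ _ hne h
    have h0 := congrFun h 0
    exact hne ((show Odd 3 by decide).strictMono_pow.injective
      (show c₁ ^ 3 = c₂ ^ 3 by linear_combination (-1 / 2) * h0))
end

section
/- Let f : ℝ → ℝ be three times continuously differentiable, suppose {x : f''(x) = 0} is finite, and suppose f'' is not nonnegative on ℝ (i.e., f''(x₀) < 0 for some x₀). Then there exists a point P = (s, t) with t < f(s) such that the set of tangent lines to the graph of f passing through P, namely the set of affine functions { x ↦ f(c) + f'(c)·(x − c) : c ∈ ℝ, f(c) + f'(c)·(s − c) = t }, does not have exactly two elements. -/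
open Set

/-- A continuous function with finitely many zeros that goes from negative to positive changes sign
at some isolated point. -/
lemma exists_sign_change {F : ℝ → ℝ} (hF : Continuous F) (hfin : {x | F x = 0}.Finite)
    {x₀ x₁ : ℝ} (hlt : x₀ < x₁) (h₀ : F x₀ < 0) (h₁ : 0 < F x₁) :
    ∃ a b d : ℝ, a < b ∧ b < d ∧ (∀ x ∈ Ioo a b, F x < 0) ∧ ∀ x ∈ Ioo b d, 0 < F x := by
  set S : Set ℝ := {x | x ∈ Icc x₀ x₁ ∧ 0 < F x} with hS
  have hne : S.Nonempty := ⟨x₁, ⟨hlt.le, le_rfl⟩, h₁⟩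
  have hbdd : BddBelow S := ⟨x₀, fun x hx => hx.1.1⟩
  set b := sInf S with hb
  have hxb : x₀ ≤ b := le_csInf hne fun x hx => hx.1.1
  have hbx : b ≤ x₁ := csInf_le hbdd ⟨⟨hlt.le, le_rfl⟩, h₁⟩
  have hleft : ∀ x, x₀ ≤ x → x < b → F x ≤ 0 := by
    intro x hx hxb
    by_contra! h
    exact absurd (csInf_le hbdd ⟨⟨hx, by linarith⟩, h⟩) (not_le.mpr hxb)
  have hb0 : 0 ≤ F b := by
    have hcl : IsClosed {x | 0 ≤ F x} := isClosed_le continuous_const hF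
    exact closure_minimal (fun x hx => hx.2.le) hcl (csInf_mem_closure hne hbdd)
  have hxb' : x₀ < b := by
    rcases hxb.lt_or_eq with h | h
    · exact h
    · rw [← h] at hb0
      linarith
  have hb0' : F b ≤ 0 := by
    have hcl : IsClosed {x | F x ≤ 0} := isClosed_le hF continuous_const
    have hsub : closure (Ioo x₀ b) ⊆ {x | F x ≤ 0} :=
      closure_minimal (fun x hx => hleft x hx.1.le hx.2) hcl
    rw [closure_Ioo hxb'.ne] at hsub
    exact hsub ⟨hxb, le_rfl⟩
  have hopen : IsOpen ({x | F x = 0} \ {b})ᶜ := (hfin.subset sdiff_subset).isClosed.isOpen_compl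
  obtain ⟨ε, hε, hball⟩ := Metric.isOpen_iff.mp hopen b (by simp)
  have hzero : ∀ x, x ≠ b → b - ε < x → x < b + ε → F x ≠ 0 := by
    intro x hx h1 h2 h0
    refine hball ?_ ⟨h0, hx⟩
    rw [Metric.mem_ball, Real.dist_eq, abs_lt]
    constructor <;> linarith
  refine ⟨max x₀ (b - ε), b, b + ε, max_lt hxb' (by linarith), by linarith, ?_, ?_⟩
  · rintro x ⟨h1, h2⟩
    obtain ⟨h3, h4⟩ := max_lt_iff.mp h1
    exact lt_of_le_of_ne (hleft x h3.le h2) (hzero x h2.ne h4 (by linarith))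
  · rintro x ⟨h1, h2⟩
    by_contra! h
    obtain ⟨y, hy, hyx⟩ := exists_lt_of_csInf_lt hne h1
    have hby : b < y := by
      refine lt_of_le_of_ne (csInf_le hbdd hy) ?_
      rintro rfl
      exact absurd hy.2 (not_lt.mpr hb0')
    obtain ⟨z, hz, hz0⟩ := intermediate_value_Icc' hyx.le hF.continuousOn
      (show (0 : ℝ) ∈ Icc (F x) (F y) from ⟨h, hy.2.le⟩)
    exact hzero z (by linarith [hz.1]) (by linarith [hz.1]) (by linarith [hz.2]) hz0

/-- If `f'` strictly decreases on `[a, b]` and strictly increases on `[b, d]`, no line is tangent to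
the graph of `f` both at a point of `[a, b)` and at a point of `(b, d]`. -/
lemma deriv_ne_of_tangents_meet {f : ℝ → ℝ} (hf : Differentiable ℝ f) {a b d : ℝ}
    (hanti : StrictAntiOn (deriv f) (Icc a b)) (hmono : StrictMonoOn (deriv f) (Icc b d))
    {u v s : ℝ} (hau : a ≤ u) (hub : u < b) (hbv : b < v) (hvd : v ≤ d)
    (h : f u + deriv f u * (s - u) = f v + deriv f v * (s - v)) : deriv f u ≠ deriv f v := by
  intro heq
  obtain ⟨ξ, hξ, hslope⟩ := exists_deriv_eq_slope f (hub.trans hbv) hf.continuous.continuousOn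
    hf.differentiableOn
  have hlt : deriv f ξ < deriv f u := by
    rcases le_total ξ b with hξb | hξb
    · exact hanti ⟨hau, hub.le⟩ ⟨hau.trans hξ.1.le, hξb⟩ hξ.1
    · rw [heq]
      exact hmono ⟨hξb, hξ.2.le.trans hvd⟩ ⟨hbv.le, hvd⟩ hξ.2
  rw [eq_div_iff (by linarith)] at hslope
  rw [← heq] at h
  nlinarith

/-- Just below the graph, near a point where `f'` turns from strictly decreasing to strictly
increasing, there is a point lying on three tangent lines with distinct slopes. -/
lemma exists_three_tangents_of_deriv_valley {f : ℝ → ℝ} (hf : Differentiable ℝ f)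
    (hf' : Continuous (deriv f)) {a b d : ℝ} (hab : a < b) (hbd : b < d)
    (hanti : StrictAntiOn (deriv f) (Icc a b)) (hmono : StrictMonoOn (deriv f) (Icc b d)) :
    ∃ s t : ℝ, t < f s ∧ ∃ u v w : ℝ,
      f u + deriv f u * (s - u) = t ∧ f v + deriv f v * (s - v) = t ∧
      f w + deriv f w * (s - w) = t ∧
      deriv f u ≠ deriv f v ∧ deriv f u ≠ deriv f w ∧ deriv f v ≠ deriv f w := by
  have hmvt : ∀ x y, x < y → ∃ ξ ∈ Ioo x y, deriv f ξ * (y - x) = f y - f x := by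
    intro x y hxy
    obtain ⟨ξ, hξ, h⟩ := exists_deriv_eq_slope f hxy hf.continuous.continuousOn
      hf.differentiableOn
    exact ⟨ξ, hξ, by rw [h, div_mul_cancel₀ _ (by linarith)]⟩
  have hnear : ∃ s ∈ Ioo b d, f s < f a + deriv f a * (s - a) := by
    have hopen : IsOpen {s | f s < f a + deriv f a * (s - a)} :=
      isOpen_lt hf.continuous (by fun_prop)
    have hb : b ∈ {s | f s < f a + deriv f a * (s - a)} := by
      obtain ⟨ξ, hξ, h⟩ := hmvt a b hab
      have := hanti ⟨le_rfl, hab.le⟩ ⟨hξ.1.le, hξ.2.le⟩ hξ.1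
      change f b < f a + deriv f a * (b - a)
      nlinarith
    obtain ⟨s, hs, hs'⟩ := ((Filter.Eventually.filter_mono nhdsWithin_le_nhds
      (hopen.mem_nhds hb)).and (Ioo_mem_nhdsGT hbd)).exists
    exact ⟨s, hs', hs⟩
  obtain ⟨s, ⟨hbs, hsd⟩, hsa⟩ := hnear
  set h : ℝ → ℝ := fun c => f c + deriv f c * (s - c) with hh
  have hc : Continuous h := by
    have := hf.continuous
    fun_prop
  have hhs : h s = f s := by simp [hh]
  have hhb : h b < f s := by
    obtain ⟨ξ, hξ, e⟩ := hmvt b s hbs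
    have := hmono ⟨le_rfl, hbd.le⟩ ⟨hξ.1.le, by linarith [hξ.2]⟩ hξ.1
    simp only [hh]
    nlinarith
  have hhd : h d < f s := by
    obtain ⟨ξ, hξ, e⟩ := hmvt s d hsd
    have := hmono ⟨by linarith [hξ.1], hξ.2.le⟩ ⟨hbd.le, le_rfl⟩ hξ.2
    simp only [hh]
    nlinarith
  obtain ⟨t, ht, hts⟩ := exists_between (max_lt hhb hhd)
  obtain ⟨hbt, hdt⟩ := max_lt_iff.mp ht
  obtain ⟨u, hu, hut⟩ := intermediate_value_Ioo' hab.le hc.continuousOn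
    (show t ∈ Ioo (h b) (h a) from ⟨hbt, hts.trans hsa⟩)
  obtain ⟨v, hv, hvt⟩ := intermediate_value_Ioo hbs.le hc.continuousOn
    (show t ∈ Ioo (h b) (h s) from ⟨hbt, hhs.symm ▸ hts⟩)
  obtain ⟨w, hw, hwt⟩ := intermediate_value_Ioo' hsd.le hc.continuousOn
    (show t ∈ Ioo (h d) (h s) from ⟨hdt, hhs.symm ▸ hts⟩)
  refine ⟨s, t, hts, u, v, w, hut, hvt, hwt, ?_, ?_, ?_⟩
  · exact deriv_ne_of_tangents_meet hf hanti hmono hu.1.le hu.2 hv.1 (hv.2.trans hsd).le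
      (hut.trans hvt.symm)
  · exact deriv_ne_of_tangents_meet hf hanti hmono hu.1.le hu.2 (hbs.trans hw.1) hw.2.le
      (hut.trans hwt.symm)
  · exact (hmono ⟨hv.1.le, (hv.2.trans hsd).le⟩ ⟨(hbs.trans hw.1).le, hw.2.le⟩
      (hv.2.trans hw.1)).ne

/-- If `f''` has finitely many zeros and is negative somewhere to the left of a point where it is
positive, then some point below the graph lies on three tangent lines with distinct slopes. -/
lemma exists_three_tangents_of_sign_change {f : ℝ → ℝ} (hf : ContDiff ℝ 2 f)
    (hfin : {x : ℝ | deriv (deriv f) x = 0}.Finite) {x₀ x₁ : ℝ} (hlt : x₀ < x₁)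
    (h₀ : deriv (deriv f) x₀ < 0) (h₁ : 0 < deriv (deriv f) x₁) :
    ∃ s t : ℝ, t < f s ∧ ∃ u v w : ℝ,
      f u + deriv f u * (s - u) = t ∧ f v + deriv f v * (s - v) = t ∧
      f w + deriv f w * (s - w) = t ∧
      deriv f u ≠ deriv f v ∧ deriv f u ≠ deriv f w ∧ deriv f v ≠ deriv f w := by
  have hf' : ContDiff ℝ 1 (deriv f) := hf.deriv'
  obtain ⟨a, b, d, hab, hbd, hn, hp⟩ :=
    exists_sign_change (hf'.continuous_deriv le_rfl) hfin hlt h₀ h₁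
  refine exists_three_tangents_of_deriv_valley (hf.differentiable (by norm_num)) hf'.continuous
    hab hbd ?_ ?_
  · exact strictAntiOn_of_deriv_neg (convex_Icc a b) hf'.continuous.continuousOn
      (by simpa using hn)
  · exact strictMonoOn_of_deriv_pos (convex_Icc b d) hf'.continuous.continuousOn
      (by simpa using hp)

/-- If `f'` is antitone, every tangent line lies above the graph of `f`. -/
lemma le_tangent_of_antitone_deriv {f : ℝ → ℝ} (hf : Differentiable ℝ f)
    (hanti : Antitone (deriv f)) (c s : ℝ) : f s ≤ f c + deriv f c * (s - c) := by
  rcases lt_trichotomy c s with hcs | rfl | hsc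
  · obtain ⟨ξ, hξ, h⟩ := exists_deriv_eq_slope f hcs hf.continuous.continuousOn
      hf.differentiableOn
    rw [eq_div_iff (by linarith)] at h
    nlinarith [hanti hξ.1.le]
  · simp
  · obtain ⟨ξ, hξ, h⟩ := exists_deriv_eq_slope f hsc hf.continuous.continuousOn
      hf.differentiableOn
    rw [eq_div_iff (by linarith)] at h
    nlinarith [hanti hξ.2.le]

/-- A point lying on three tangent lines with distinct slopes has illumination index other than
two. -/
lemma ncard_tangents_ne_two {f : ℝ → ℝ} {s t u v w : ℝ}
    (hu : f u + deriv f u * (s - u) = t) (hv : f v + deriv f v * (s - v) = t)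
    (hw : f w + deriv f w * (s - w) = t) (huv : deriv f u ≠ deriv f v)
    (huw : deriv f u ≠ deriv f w) (hvw : deriv f v ≠ deriv f w) :
    {g : ℝ → ℝ | ∃ c : ℝ, f c + deriv f c * (s - c) = t ∧
      g = fun x => f c + deriv f c * (x - c)}.ncard ≠ 2 := by
  intro hcard
  have hinj : ∀ p q, deriv f p ≠ deriv f q →
      (fun x => f p + deriv f p * (x - p)) ≠ fun x => f q + deriv f q * (x - q) := by
    intro p q hpq h
    have e₀ := congrFun h 0
    have e₁ := congrFun h 1
    apply hpq
    linarith
  have hlt := (two_lt_ncard_iff (finite_of_ncard_ne_zero (hcard.trans_ne two_ne_zero))).mpr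
    ⟨_, _, _, ⟨u, hu, rfl⟩, ⟨v, hv, rfl⟩, ⟨w, hw, rfl⟩, hinj u v huv, hinj u w huw,
      hinj v w hvw⟩
  exact hlt.ne' hcard

/-- **Theorem 2 (Horwitz).** If `f ∈ C³(ℝ)`, `f''` has finitely many zeros, and `f''` is
not nonnegative on `ℝ`, then some point `(s, t)` below the graph of `f` has illumination
index different from `2`: the set of tangent lines to the graph passing through `(s, t)`
does not have exactly two elements. -/
theorem converse_exists_point_index_ne_two
    (f : ℝ → ℝ) (hf : ContDiff ℝ 3 f)
    (hfin : {x : ℝ | iteratedDeriv 2 f x = 0}.Finite)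
    (hneg : ∃ x₀ : ℝ, iteratedDeriv 2 f x₀ < 0) :
    ∃ s t : ℝ, t < f s ∧
      {g : ℝ → ℝ | ∃ c : ℝ, f c + deriv f c * (s - c) = t ∧
        g = fun x => f c + deriv f c * (x - c)}.ncard ≠ 2 := by
  have hf2 : ContDiff ℝ 2 f := hf.of_le (by norm_num)
  have h2 : iteratedDeriv 2 f = deriv (deriv f) := by
    rw [iteratedDeriv_succ, iteratedDeriv_one]
  rw [h2] at hfin hneg
  obtain ⟨x₀, h₀⟩ := hneg
  by_cases hpos : ∃ x₁, 0 < deriv (deriv f) x₁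
  · obtain ⟨x₁, h₁⟩ := hpos
    have hne : x₀ ≠ x₁ := by
      rintro rfl
      linarith
    rcases hne.lt_or_gt with hlt | hlt
    · obtain ⟨s, t, hts, u, v, w, hu, hv, hw, huv, huw, hvw⟩ :=
        exists_three_tangents_of_sign_change hf2 hfin hlt h₀ h₁
      exact ⟨s, t, hts, ncard_tangents_ne_two hu hv hw huv huw hvw⟩
    · set g : ℝ → ℝ := fun x => f (-x) with hg
      have hg' : deriv g = fun x => -deriv f (-x) := by
        funext x
        exact deriv_comp_neg f x
      have hg'' : deriv (deriv g) = fun x => deriv (deriv f) (-x) := by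
        funext x
        rw [hg', deriv.fun_neg, deriv_comp_neg, neg_neg]
      have hgfin : {x : ℝ | deriv (deriv g) x = 0}.Finite := by
        rw [hg'']
        exact hfin.preimage neg_injective.injOn
      obtain ⟨s, t, hts, u, v, w, hu, hv, hw, huv, huw, hvw⟩ :=
        exists_three_tangents_of_sign_change (f := g) (hf2.comp contDiff_neg) hgfin
          (neg_lt_neg hlt) (by simpa [hg''] using h₀) (by simpa [hg''] using h₁)
      simp only [hg', ne_eq, neg_inj] at hu hv hw huv huw hvw
      simp only [hg] at hts hu hv hw
      exact ⟨-s, t, hts, ncard_tangents_ne_two (u := -u) (v := -v) (w := -w)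
        (by linarith) (by linarith) (by linarith) huv huw hvw⟩
  · push Not at hpos
    have hd : Differentiable ℝ f := hf2.differentiable (by norm_num)
    have hd' : Differentiable ℝ (deriv f) :=
      (hf2.deriv' : ContDiff ℝ 1 (deriv f)).differentiable (by norm_num)
    refine ⟨0, f 0 - 1, by linarith, ?_⟩
    rw [eq_empty_of_forall_notMem (s := {g : ℝ → ℝ | _})]
    · simp
    · rintro g ⟨c, hc, -⟩
      linarith [le_tangent_of_antitone_deriv hd (antitone_of_deriv_nonpos hd' hpos) c 0]
end

section
/- Let r be an odd positive integer, let f : ℝ → ℝ be of class C^{r+1}, and suppose f^{(r+1)} is nonnegative on [a, b] (with a < b) and {x ∈ [a, b] : f^{(r+1)}(x) = 0} is finite. Then the function P_b − P_a, where P_c denotes the Taylor polynomial of order r of f centered at c, has precisely one real zero, and this zero lies strictly between a and b. -/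
/-- The Taylor polynomial of order `r` of `f` centered at `c`, as a function on `ℝ`. -/
noncomputable def taylorPoly (f : ℝ → ℝ) (r : ℕ) (c : ℝ) : ℝ → ℝ :=
  fun x => ∑ k ∈ Finset.range (r + 1), iteratedDeriv k f c / (k.factorial : ℝ) * (x - c) ^ k

theorem hasDerivAt_taylorPoly_center {f : ℝ → ℝ} {r : ℕ} (hf : ContDiff ℝ (r + 1 : ℕ) f)
    (x c : ℝ) :
    HasDerivAt (fun t => taylorPoly f r t x)
      (iteratedDeriv (r + 1) f c / (r.factorial : ℝ) * (x - c) ^ r) c := by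
  have hderiv : ∀ k ≤ r, HasDerivAt (iteratedDeriv k f) (iteratedDeriv (k + 1) f c) c := by
    intro k hk
    rw [iteratedDeriv_succ]
    exact (hf.differentiable_iteratedDeriv k (by exact_mod_cast Nat.lt_succ_of_le hk) c).hasDerivAt
  clear hf
  induction r with
  | zero => simpa [taylorPoly] using hderiv 0 le_rfl
  | succ n ih =>
    have hlast := ((hderiv (n + 1) le_rfl).div_const ((n + 1).factorial : ℝ)).mul
      (((hasDerivAt_id c).const_sub x).pow (n + 1))
    have hsum := (ih fun k hk => hderiv k (by omega)).add hlast
    have heq : (fun t => taylorPoly f (n + 1) t x) = (fun t => taylorPoly f n t x) +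
        (fun t => iteratedDeriv (n + 1) f t / ((n + 1).factorial : ℝ)) *
          (fun t => x - id t) ^ (n + 1) := by
      funext t
      simp [taylorPoly, Finset.sum_range_succ _ (n + 1)]
    rw [heq]
    refine hsum.congr_deriv ?_
    have hn : (n.factorial : ℝ) ≠ 0 := by positivity
    simp only [Nat.factorial_succ, Nat.cast_mul, Nat.add_sub_cancel, id, Pi.pow_apply]
    field_simp
    push_cast
    ring

theorem lt_of_hasDerivAt_nonneg_of_finite_zeros {h h' : ℝ → ℝ} {a b : ℝ} (hab : a < b)
    (hderiv : ∀ t, HasDerivAt h (h' t) t) (hnonneg : ∀ t ∈ Set.Ioo a b, 0 ≤ h' t)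
    (hfin : {t ∈ Set.Ioo a b | h' t = 0}.Finite) : h a < h b := by
  have hmono : MonotoneOn h (Set.Icc a b) := by
    refine monotoneOn_of_deriv_nonneg (convex_Icc a b)
      (fun t _ => (hderiv t).continuousAt.continuousWithinAt)
      (fun t _ => (hderiv t).differentiableAt.differentiableWithinAt) fun t ht => ?_
    rw [interior_Icc] at ht
    rw [(hderiv t).deriv]
    exact hnonneg t ht
  have hleft := Set.left_mem_Icc.2 hab.le
  have hright := Set.right_mem_Icc.2 hab.le
  refine lt_of_le_of_ne (hmono hleft hright hab.le) fun heq => ?_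
  refine Set.Ioo_infinite hab (hfin.subset fun t ht => ⟨ht, ?_⟩)
  have hconst : h =ᶠ[nhds t] fun _ => h a := by
    filter_upwards [isOpen_Ioo.mem_nhds ht] with s hs
    have hs' := Set.Ioo_subset_Icc_self hs
    exact le_antisymm ((hmono hs' hright hs.2.le).trans_eq heq.symm) (hmono hleft hs' hs.1.le)
  exact (hderiv t).unique ((hasDerivAt_const t (h a)).congr_of_eventuallyEq hconst)

theorem lt_of_hasDerivAt_mul_of_finite_zeros {h g w : ℝ → ℝ} {a b : ℝ} (hab : a < b)
    (hderiv : ∀ t, HasDerivAt h (g t * w t) t)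
    (hnonneg : ∀ t ∈ Set.Icc a b, 0 ≤ g t) (hfin : {t ∈ Set.Icc a b | g t = 0}.Finite)
    (hw : ∀ t ∈ Set.Ioo a b, 0 < w t) : h a < h b := by
  refine lt_of_hasDerivAt_nonneg_of_finite_zeros hab hderiv
    (fun t ht => mul_nonneg (hnonneg t (Set.Ioo_subset_Icc_self ht)) (hw t ht).le)
    (hfin.subset fun t ht => ⟨Set.Ioo_subset_Icc_self ht.1, ?_⟩)
  exact (mul_eq_zero.1 ht.2).resolve_right (hw t ht.1).ne'

/-- **Lemma (Horwitz, Section 3).** Let `r` be an odd positive integer and `f ∈ C^{r+1}`.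
If `f^{(r+1)}` is nonnegative on `[a, b]` with finitely many zeros there, then
`P_b - P_a` has precisely one real zero, and it lies strictly between `a` and `b`. -/
theorem taylor_difference_unique_zero
    (r : ℕ) (hr : Odd r) (hrpos : 0 < r)
    (f : ℝ → ℝ) (hf : ContDiff ℝ (r + 1 : ℕ) f)
    (a b : ℝ) (hab : a < b)
    (hnonneg : ∀ x ∈ Set.Icc a b, 0 ≤ iteratedDeriv (r + 1) f x)
    (hfin : {x ∈ Set.Icc a b | iteratedDeriv (r + 1) f x = 0}.Finite) :
    ∃ c : ℝ, c ∈ Set.Ioo a b ∧ taylorPoly f r b c - taylorPoly f r a c = 0 ∧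
      ∀ c' : ℝ, taylorPoly f r b c' - taylorPoly f r a c' = 0 → c' = c := by
  have hcenter (x c : ℝ) := hasDerivAt_taylorPoly_center hf x c
  have hfact : (0 : ℝ) < r.factorial := by positivity
  have hmono : StrictMono fun x => taylorPoly f r b x - taylorPoly f r a x := by
    intro x y hxy
    have := lt_of_hasDerivAt_mul_of_finite_zeros
      (h := fun t => taylorPoly f r t y - taylorPoly f r t x)
      (w := fun t => ((y - t) ^ r - (x - t) ^ r) / r.factorial) hab
      (fun t => ((hcenter y t).sub (hcenter x t)).congr_deriv (by ring)) hnonneg hfin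
      (fun t _ => div_pos (sub_pos.2 (hr.strictMono_pow (by linarith))) hfact)
    simp only at this ⊢
    linarith
  have hb : 0 < taylorPoly f r b b - taylorPoly f r a b :=
    sub_pos.2 <| lt_of_hasDerivAt_mul_of_finite_zeros (h := fun t => taylorPoly f r t b)
      (w := fun t => (b - t) ^ r / r.factorial) hab
      (fun t => (hcenter b t).congr_deriv (by ring)) hnonneg hfin
      (fun t ht => div_pos (pow_pos (sub_pos.2 ht.2) r) hfact)
  have ha : taylorPoly f r b a - taylorPoly f r a a < 0 := by
    have := lt_of_hasDerivAt_mul_of_finite_zeros (h := fun t => -taylorPoly f r t a)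
      (w := fun t => -(a - t) ^ r / r.factorial) hab
      (fun t => (hcenter a t).neg.congr_deriv (by ring)) hnonneg hfin
      (fun t ht => div_pos (neg_pos.2 (hr.pow_neg (sub_neg.2 ht.1))) hfact)
    linarith
  have hcont : Continuous fun x => taylorPoly f r b x - taylorPoly f r a x := by
    unfold taylorPoly
    fun_prop
  obtain ⟨c, hc, hzero⟩ := intermediate_value_Ioo hab.le hcont.continuousOn ⟨ha, hb⟩
  exact ⟨c, hc, hzero, fun c' hc' => hmono.injective (hc'.trans hzero.symm)⟩
end

section
/- Let r be an odd positive integer, let f : ℝ → ℝ be of class C^{r+1}, and suppose f^{(r+1)} is nonnegative on [a, b] (with a < b) and {x ∈ [a, b] : f^{(r+1)}(x) = 0} is finite. Then the error function E_a(x) = f(x) − P_a(x) is strictly increasing on (a, b), and E_b(x) = f(x) − P_b(x) is strictly decreasing on (a, b), where P_c denotes the Taylor polynomial of order r of f centered at c. -/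
theorem strictMonoOn_Icc_of_deriv_nonneg_of_finite_zeros {f : ℝ → ℝ} {a b : ℝ}
    (hf : Differentiable ℝ f) (hnonneg : ∀ x ∈ Set.Icc a b, 0 ≤ deriv f x)
    (hfin : {x ∈ Set.Icc a b | deriv f x = 0}.Finite) :
    StrictMonoOn f (Set.Icc a b) := by
  have hmono : MonotoneOn f (Set.Icc a b) :=
    monotoneOn_of_deriv_nonneg (convex_Icc a b) hf.continuous.continuousOn
      hf.differentiableOn fun x hx => hnonneg x (interior_subset hx)
  intro x hx y hy hxy
  refine lt_of_le_of_ne (hmono hx hy hxy.le) fun heq => ?_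
  refine Set.Ioo_infinite hxy (hfin.subset fun z hz => ?_)
  have hsub : ∀ w ∈ Set.Ioo x y, w ∈ Set.Icc a b := fun w hw =>
    ⟨hx.1.trans hw.1.le, hw.2.le.trans hy.2⟩
  have hconst : f =ᶠ[nhds z] fun _ => f x := by
    filter_upwards [isOpen_Ioo.mem_nhds hz] with w hw
    exact le_antisymm ((hmono (hsub w hw) hy hw.2.le).trans heq.ge)
      (hmono hx (hsub w hw) hw.1.le)
  exact ⟨hsub z hz, by rw [hconst.deriv_eq, deriv_const]⟩

theorem taylorPoly_self (f : ℝ → ℝ) (n : ℕ) (c : ℝ) : taylorPoly f n c c = f c := by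
  simp [taylorPoly, Finset.sum_range_succ']

theorem hasDerivAt_taylorPoly_succ (f : ℝ → ℝ) (n : ℕ) (c x : ℝ) :
    HasDerivAt (taylorPoly f (n + 1) c) (taylorPoly (deriv f) n c x) x := by
  unfold taylorPoly
  simp_rw [Finset.sum_range_succ' _ (n + 1)]
  simp only [pow_zero, mul_one]
  refine HasDerivAt.add_const _ (HasDerivAt.fun_sum fun k _ => ?_)
  refine ((((hasDerivAt_id x).sub_const c).pow (k + 1)).const_mul
    (iteratedDeriv (k + 1) f c / ((k + 1).factorial : ℝ))).congr_deriv ?_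
  rw [iteratedDeriv_succ', Nat.factorial_succ]
  have hk : ((k : ℝ) + 1) ≠ 0 := by positivity
  have hk' : (k.factorial : ℝ) ≠ 0 := by positivity
  push_cast
  simp only [id]
  field_simp

theorem hasDerivAt_taylorPoly_remainder_succ {f : ℝ → ℝ} (hf : Differentiable ℝ f)
    (n : ℕ) (c x : ℝ) :
    HasDerivAt (fun y => f y - taylorPoly f (n + 1) c y)
      (deriv f x - taylorPoly (deriv f) n c x) x :=
  (hf x).hasDerivAt.sub (hasDerivAt_taylorPoly_succ f n c x)

/-- The remainder at the left endpoint is strictly increasing; at the right endpoint the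
monotonicity alternates with the parity of the order. -/
theorem strictMonoOn_taylorPoly_remainder {a b : ℝ} (hab : a < b) (n : ℕ) {f : ℝ → ℝ}
    (hf : ContDiff ℝ (n + 1 : ℕ) f)
    (hnonneg : ∀ x ∈ Set.Icc a b, 0 ≤ iteratedDeriv (n + 1) f x)
    (hfin : {x ∈ Set.Icc a b | iteratedDeriv (n + 1) f x = 0}.Finite) :
    StrictMonoOn (fun x => f x - taylorPoly f n a x) (Set.Icc a b) ∧
    StrictMonoOn (fun x => (-1) ^ n * (f x - taylorPoly f n b x)) (Set.Icc a b) := by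
  induction n generalizing f with
  | zero =>
    simp only [zero_add, iteratedDeriv_one] at hnonneg hfin
    have h := strictMonoOn_Icc_of_deriv_nonneg_of_finite_zeros
      (hf.differentiable (by simp)) hnonneg hfin
    constructor <;> intro x hx y hy hxy <;> simpa [taylorPoly] using h hx hy hxy
  | succ n ih =>
    have hd : Differentiable ℝ f := hf.differentiable (by simp)
    have hf' : ContDiff ℝ (n + 1 : ℕ) (deriv f) := by
      have : ContDiff ℝ ((n + 1 : ℕ) + 1) f := by exact_mod_cast hf
      exact (contDiff_succ_iff_deriv.1 this).2.2
    rw [iteratedDeriv_succ'] at hnonneg hfin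
    obtain ⟨ha, hb⟩ := ih hf' hnonneg hfin
    have hE := hasDerivAt_taylorPoly_remainder_succ hd n
    have hEb := fun x => (hE b x).const_mul ((-1) ^ (n + 1))
    constructor
    · refine strictMonoOn_of_deriv_pos (convex_Icc a b)
        (fun x _ => (hE a x).continuousAt.continuousWithinAt) fun x hx => ?_
      rw [interior_Icc] at hx
      rw [(hE a x).deriv]
      simpa [taylorPoly_self] using
        ha (Set.left_mem_Icc.2 hab.le) (Set.Ioo_subset_Icc_self hx) hx.1
    · refine strictMonoOn_of_deriv_pos (convex_Icc a b)
        (fun x _ => (hEb x).continuousAt.continuousWithinAt) fun x hx => ?_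
      rw [interior_Icc] at hx
      rw [(hEb x).deriv]
      have := hb (Set.Ioo_subset_Icc_self hx) (Set.right_mem_Icc.2 hab.le) hx.2
      simp only [taylorPoly_self, sub_self, mul_zero] at this
      rw [pow_succ]
      linarith

/-- Let `r` be an odd positive integer and `f ∈ C^{r+1}` with `f^{(r+1)}` nonnegative on
`[a, b]` with finitely many zeros there. Then the remainder `E_a = f - P_a` is strictly
increasing on `(a, b)` and `E_b = f - P_b` is strictly decreasing on `(a, b)`. -/
theorem taylor_remainders_monotone
    (r : ℕ) (hr : Odd r) (hrpos : 0 < r)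
    (f : ℝ → ℝ) (hf : ContDiff ℝ (r + 1 : ℕ) f)
    (a b : ℝ) (hab : a < b)
    (hnonneg : ∀ x ∈ Set.Icc a b, 0 ≤ iteratedDeriv (r + 1) f x)
    (hfin : {x ∈ Set.Icc a b | iteratedDeriv (r + 1) f x = 0}.Finite) :
    StrictMonoOn (fun x => f x - taylorPoly f r a x) (Set.Ioo a b) ∧
    StrictAntiOn (fun x => f x - taylorPoly f r b x) (Set.Ioo a b) := by
  obtain ⟨ha, hb⟩ := strictMonoOn_taylorPoly_remainder hab r hf hnonneg hfin
  refine ⟨ha.mono Set.Ioo_subset_Icc_self, fun x hx y hy hxy => ?_⟩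
  have := hb (Set.Ioo_subset_Icc_self hx) (Set.Ioo_subset_Icc_self hy) hxy
  simp only [hr.neg_one_pow] at this
  linarith
end
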